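/- arXiv:1807.05665 — 5 statements merged into one kernel-verified Lean document; each statement's English description precedes it below -/
import Mathlib

section
/- Let G=(V,E) be the complete graph on n vertices, let L be a sequence of moves, and let τ_0 : V → {−1,+1} be an initial configuration. If H is an L-good, L-neighbor-wise independent directed acyclic graph, then the rank (over the rationals) of the matrix P_{L,τ_0} is at least the number of arcs of H, i.e., rank(P_{L,τ_0}) ≥ |E(H)|. -/
open Finset MeasureTheory ProbabilityTheory Filter
open scoped Classical

/-- Edges of the complete graph on `n` vertices: ordered pairs `(a,b)` with `a < b`. -/
abbrev mcEdge (n : ℕ) := {e : Fin n × Fin n // e.1 < e.2}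

/-- A configuration assigns `±1` to every vertex. -/
def IsPM1 {n : ℕ} (τ : Fin n → ℝ) : Prop := ∀ v, τ v = 1 ∨ τ v = -1

/-- The Hamiltonian `H(τ) = -(1/2) ∑_{u<v} X_{uv} τ(u) τ(v)`. -/
noncomputable def mcH {n : ℕ} (X : mcEdge n → ℝ) (τ : Fin n → ℝ) : ℝ :=
  -(1/2) * ∑ e : mcEdge n, X e * τ e.1.1 * τ e.1.2

/-- Flipping a single vertex. -/
def mcStep {n : ℕ} (τ : Fin n → ℝ) (v : Fin n) : Fin n → ℝ :=
  Function.update τ v (-(τ v))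

/-- The configuration reached from `τ` after performing all moves of `L`. -/
def mcRun {n : ℕ} (τ : Fin n → ℝ) : List (Fin n) → (Fin n → ℝ)
  | [] => τ
  | v :: L => mcRun (mcStep τ v) L

/-- `L` is an improving sequence of moves from `τ` with respect to edge weights `X`:
every single flip strictly increases the Hamiltonian. -/
def mcImproving {n : ℕ} (X : mcEdge n → ℝ) : (Fin n → ℝ) → List (Fin n) → Prop
  | _, [] => True
  | τ, v :: L => mcH X τ < mcH X (mcStep τ v) ∧ mcImproving X (mcStep τ v) L

/-- `L` is `ε`-slowly improving from `τ` w.r.t. `X`. -/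
def mcSlowImproving {n : ℕ} (X : mcEdge n → ℝ) (ε : ℝ) (τ : Fin n → ℝ)
    (L : List (Fin n)) : Prop :=
  mcImproving X τ L ∧ mcH X (mcRun τ L) - mcH X τ ≤ ε

/-- The configuration `τ_t` after the first `t` moves of `L`. -/
def mcConfAt {n : ℕ} (τ0 : Fin n → ℝ) (L : List (Fin n)) (t : ℕ) : Fin n → ℝ :=
  mcRun τ0 (L.take t)

/-- The entry `M_{L,τ0}[{a,b},t]` of the matrix `M`. -/
noncomputable def mcM {n : ℕ} (L : List (Fin n)) (τ0 : Fin n → ℝ) (a b : Fin n)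
    (t : Fin L.length) : ℚ :=
  if L.get t = a ∨ L.get t = b then
    (if mcConfAt τ0 L (t + 1) a ≠ mcConfAt τ0 L (t + 1) b then 1 else -1)
  else 0

/-- `(t₁,t₂)` is a pair (of nearest moves of the same vertex) of `L`. -/
def IsPairOf {n : ℕ} (L : List (Fin n)) (p : Fin L.length × Fin L.length) : Prop :=
  p.1 < p.2 ∧ L.get p.1 = L.get p.2 ∧ ∀ t, p.1 < t → t < p.2 → L.get t ≠ L.get p.1

/-- The set `Γ(L)` of pairs of `L`, as a type. -/
abbrev mcPair {n : ℕ} (L : List (Fin n)) := {p : Fin L.length × Fin L.length // IsPairOf L p}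

/-- The entry `P_{L,τ0}[{a,b},C]` for an unordered edge `{a,b}` and a pair `C`. -/
noncomputable def mcPval {n : ℕ} (L : List (Fin n)) (τ0 : Fin n → ℝ) (a b : Fin n)
    (C : mcPair L) : ℚ :=
  mcM L τ0 a b C.1.1 + mcM L τ0 a b C.1.2

/-- The matrix `P_{L,τ0}` with rows indexed by edges and columns indexed by pairs. -/
noncomputable def mcP {n : ℕ} (L : List (Fin n)) (τ0 : Fin n → ℝ) :
    Matrix (mcEdge n) (mcPair L) ℚ :=
  fun e C => mcPval L τ0 e.1.1 e.1.2 C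


/-- The ordered pair `v u` is an `L`-good-arc: there is a pair `C ∈ Γ(L)` for `v`
(i.e. with `L(C.1) = v`) such that `P_{L,τ0}[{u,v},C] ≠ 0`. -/
def mcGoodArc {n : ℕ} (L : List (Fin n)) (τ0 : Fin n → ℝ) (v u : Fin n) : Prop :=
  v ≠ u ∧ ∃ C : mcPair L, L.get C.1.1 = v ∧ mcPval L τ0 u v C ≠ 0

/-- A directed graph, given by its finite set `A` of arcs, has no closed directed walk
(equivalently, it is acyclic). -/
def IsDAG {α : Type*} (A : Finset (α × α)) : Prop :=
  ∀ (v : α) (l : List α), List.Chain (fun a b => (a, b) ∈ A) v l → (l.getLastD v, v) ∉ A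

/-- The directed graph with arc set `A` (on a subset of the vertices occurring in `L`)
is `L`-good: every arc is an `L`-good-arc. -/
def mcLGood {n : ℕ} (L : List (Fin n)) (τ0 : Fin n → ℝ) (A : Finset (Fin n × Fin n)) : Prop :=
  ∀ p ∈ A, p.1 ∈ L.toFinset ∧ p.2 ∈ L.toFinset ∧ mcGoodArc L τ0 p.1 p.2

/-- The directed graph with arc set `A` is `L`-neighbor-wise independent: for every vertex `v`
there is an ordering `u 0, …, u (m-1)` of the out-neighbors of `v` together with pairs
`C 0, …, C (m-1) ∈ Γ(L)` for `v` such that `P_{L,τ0}[{v,u i}, C i] ≠ 0` and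
`P_{L,τ0}[{v,u j}, C i] = 0` for all `j > i`. -/
def mcLNbrIndep {n : ℕ} (L : List (Fin n)) (τ0 : Fin n → ℝ)
    (A : Finset (Fin n × Fin n)) : Prop :=
  ∀ v : Fin n, ∃ (m : ℕ) (u : Fin m → Fin n) (C : Fin m → mcPair L),
    Function.Injective u ∧
    (∀ w : Fin n, (v, w) ∈ A ↔ ∃ i, u i = w) ∧
    (∀ i, L.get (C i).1.1 = v) ∧
    (∀ i, mcPval L τ0 v (u i) (C i) ≠ 0) ∧
    (∀ i j, i < j → mcPval L τ0 v (u j) (C i) = 0)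

theorem IsDAG.wellFounded {α : Type*} [Finite α] {A : Finset (α × α)} (h : IsDAG A) :
    WellFounded (Relation.TransGen fun a b => (a, b) ∈ A) := by
  have : Std.Irrefl (Relation.TransGen fun a b => (a, b) ∈ A) := by
    refine ⟨fun v hv => ?_⟩
    obtain ⟨b, hvb, hbv⟩ := Relation.TransGen.tail'_iff.1 hv
    obtain ⟨l, hl, hlast⟩ := List.exists_isChain_cons_of_relationReflTransGen hvb
    refine h v l hl ?_
    rwa [← List.getLast_eq_getLastD (List.cons_ne_nil v l), hlast]
  exact Finite.wellFounded_of_trans_of_irrefl _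

/-- The size of a linearly independent family of rows is a lower bound for the rank. -/
theorem Matrix.card_le_rank_of_linearIndependent_row {ι m n K : Type*} [Fintype ι] [Finite m]
    [Fintype n] [Field K] (M : Matrix m n K) (e : ι → m)
    (h : LinearIndependent K fun i => M (e i)) : Fintype.card ι ≤ M.rank := by
  rw [M.rank_eq_finrank_span_row, ← finrank_span_eq_card h]
  refine Submodule.finrank_mono (Submodule.span_mono ?_)
  rintro _ ⟨i, rfl⟩
  exact ⟨e i, rfl⟩

theorem mcPval_comm {n : ℕ} (L : List (Fin n)) (τ0 : Fin n → ℝ) (a b : Fin n) (C : mcPair L) :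
    mcPval L τ0 a b C = mcPval L τ0 b a C := by
  simp only [mcPval, mcM, or_comm, ne_comm]

theorem mcPval_eq_zero {n : ℕ} (L : List (Fin n)) (τ0 : Fin n → ℝ) {a b : Fin n} {C : mcPair L}
    (ha : L.get C.1.1 ≠ a) (hb : L.get C.1.1 ≠ b) : mcPval L τ0 a b C = 0 := by
  have ha' : L.get C.1.2 ≠ a := C.2.2.1 ▸ ha
  have hb' : L.get C.1.2 ≠ b := C.2.2.1 ▸ hb
  rw [mcPval, mcM, mcM, if_neg (by tauto), if_neg (by tauto), add_zero]

theorem exists_mcP_row_eq {n : ℕ} (L : List (Fin n)) (τ0 : Fin n → ℝ) {a b : Fin n}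
    (h : a ≠ b) : ∃ e : mcEdge n, ∀ C, mcP L τ0 e C = mcPval L τ0 a b C := by
  rcases lt_or_gt_of_ne h with h | h
  · exact ⟨⟨(a, b), h⟩, fun _ => rfl⟩
  · exact ⟨⟨(b, a), h⟩, fun C => mcPval_comm L τ0 b a C⟩

/-- rank lower bound from an `L`-good `L`-neighbor-wise independent DAG.
If the directed graph with arc set `A` is `L`-good, `L`-neighbor-wise independent and acyclic,
then `rank(P_{L,τ0}) ≥ |E(H)| = |A|`. -/
theorem rank_ge_of_good_nbrIndep_dag_maxcut {n : ℕ} (L : List (Fin n)) (τ0 : Fin n → ℝ)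
    (hτ0 : IsPM1 τ0) (A : Finset (Fin n × Fin n))
    (hgood : mcLGood L τ0 A) (hindep : mcLNbrIndep L τ0 A) (hdag : IsDAG A) :
    A.card ≤ (mcP L τ0).rank := by
  have hrow : ∀ p : A, ∃ e : mcEdge n, ∀ C, mcP L τ0 e C = mcPval L τ0 p.1.1 p.1.2 C :=
    fun p => exists_mcP_row_eq L τ0 (hgood p.1 p.2).2.2.1
  choose e he using hrow
  rw [← Fintype.card_coe]
  refine Matrix.card_le_rank_of_linearIndependent_row _ e ?_
  rw [Fintype.linearIndependent_iff]
  intro c hc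
  suffices H : ∀ v w, ∀ h : (v, w) ∈ A, c ⟨(v, w), h⟩ = 0 from fun p => H p.1.1 p.1.2 p.2
  intro v
  induction v using hdag.wellFounded.induction with
  | _ v ihv =>
    obtain ⟨m, u, C, -, hu, hC, hne, hzero⟩ := hindep v
    suffices H : ∀ i, ∀ h : (v, u i) ∈ A, c ⟨(v, u i), h⟩ = 0 by
      intro w h
      obtain ⟨i, rfl⟩ := (hu w).1 h
      exact H i h
    intro i
    induction i using WellFoundedLT.induction with
    | _ i ihi =>
      intro h
      have hsum : ∑ p, c p * mcPval L τ0 p.1.1 p.1.2 (C i) = 0 := by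
        simpa [Finset.sum_apply, he] using congrFun hc (C i)
      rw [Finset.sum_eq_single ⟨(v, u i), h⟩] at hsum
      · exact (mul_eq_zero.1 hsum).resolve_right (hne i)
      · rintro ⟨⟨a, b⟩, hab⟩ - hp
        by_cases hav : a = v
        · subst hav
          obtain ⟨j, rfl⟩ := (hu b).1 hab
          rcases lt_trichotomy j i with hj | rfl | hj
          · rw [ihi j hj hab, zero_mul]
          · exact absurd rfl hp
          · rw [hzero i j hj, mul_zero]
        · by_cases hbv : b = v
          · subst hbv
            rw [ihv a (.single hab) b hab, zero_mul]
          · rw [mcPval_eq_zero L τ0 (hC i ▸ Ne.symm hav) (hC i ▸ Ne.symm hbv), mul_zero]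
      · exact fun h' => absurd (Finset.mem_univ _) h'
end

section
/- Fix an integer k ≥ 2, let G=(V,E) be a finite simple graph, let L be a sequence of moves for max-k-cut that is valid from an initial configuration τ_0 : V → [k]. If v ∈ V \ S(L), then P_{L,τ_0}[{a,v},C] = 0 for every cycle C ∈ Γ(L) and every edge {a,v} ∈ E. -/
open Finset MeasureTheory ProbabilityTheory Filter
open scoped Classical

/-- A move `(v,p,q)` for max-`k`-cut: vertex `v` moves from part `p` to part `q`. -/
abbrev KMove (n k : ℕ) := Fin n × Fin k × Fin k

/-- The inner product `⟨σ(i),σ(j)⟩` of the unit simplex vectors: `1` if `i = j`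
and `−1/(k−1)` otherwise. -/
noncomputable def sigmaDot (k : ℕ) (i j : Fin k) : ℝ :=
  if i = j then 1 else -(1 / ((k : ℝ) - 1))

/-- Performing the move `m = (v,p,q)`: vertex `v` is placed in part `q`. -/
def kStep {n k : ℕ} (τ : Fin n → Fin k) (m : KMove n k) : Fin n → Fin k :=
  Function.update τ m.1 m.2.2

/-- The configuration reached from `τ` after performing all moves of `L`. -/
def kRun {n k : ℕ} (τ : Fin n → Fin k) : List (KMove n k) → (Fin n → Fin k)
  | [] => τ
  | m :: L => kRun (kStep τ m) L

/-- `L` is a valid sequence of moves from `τ`: each move `(v,p,q)` has `p ≠ q` and is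
applied when `τ(v) = p`. -/
def kValid {n k : ℕ} : (Fin n → Fin k) → List (KMove n k) → Prop
  | _, [] => True
  | τ, m :: L => τ m.1 = m.2.1 ∧ m.2.1 ≠ m.2.2 ∧ kValid (kStep τ m) L

/-- The configuration `τ_t` after the first `t` moves of `L`. -/
def kConfAt {n k : ℕ} (τ0 : Fin n → Fin k) (L : List (KMove n k)) (t : ℕ) : Fin n → Fin k :=
  kRun τ0 (L.take t)

/-- The entry `M_{L,τ0}[{a,b},t]` of the matrix `M` for max-`k`-cut. -/
noncomputable def kM {n k : ℕ} (L : List (KMove n k)) (τ0 : Fin n → Fin k) (a b : Fin n)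
    (t : Fin L.length) : ℚ :=
  if (a = (L.get t).1 ∧ (L.get t).2.2 = kConfAt τ0 L (t + 1) b) ∨
     (b = (L.get t).1 ∧ (L.get t).2.2 = kConfAt τ0 L (t + 1) a) then 1
  else if (a = (L.get t).1 ∧ (L.get t).2.1 = kConfAt τ0 L (t + 1) b) ∨
     (b = (L.get t).1 ∧ (L.get t).2.1 = kConfAt τ0 L (t + 1) a) then -1
  else 0

/-- The set of time steps `T` is a circuit over the vertex `v` in `L`: all moves at times of
`T` are moves of `v`, consecutive moves (in increasing order of time) match up
(`q_{t_i} = p_{t_{i+1}}`), and the last move returns to the starting part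
(`q_{t_w} = p_{t_1}`). -/
def IsCircuit {n k : ℕ} (L : List (KMove n k)) (v : Fin n)
    (T : Finset (Fin L.length)) : Prop :=
  T.Nonempty ∧ (∀ t ∈ T, (L.get t).1 = v) ∧
  List.Chain' (fun a b => (L.get a).2.2 = (L.get b).2.1) (T.sort (· ≤ ·)) ∧
  ∀ h : T.Nonempty, (L.get (T.max' h)).2.2 = (L.get (T.min' h)).2.1

/-- A cycle is an inclusion-wise minimal circuit. -/
def IsCycle {n k : ℕ} (L : List (KMove n k)) (v : Fin n)
    (T : Finset (Fin L.length)) : Prop :=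
  IsCircuit L v T ∧ ∀ T' ⊂ T, ¬ IsCircuit L v T'

/-- The set `Γ(L)` of cycles of `L`, as a type: a vertex together with the set of time
steps of a cycle over it. -/
abbrev KCycle {n k : ℕ} (L : List (KMove n k)) :=
  {c : Fin n × Finset (Fin L.length) // IsCycle L c.1 c.2}

/-- The entry `P_{L,τ0}[{a,b},C] = ∑_{t ∈ T(C)} M_{L,τ0}[{a,b},t]`. -/
noncomputable def kPval {n k : ℕ} (L : List (KMove n k)) (τ0 : Fin n → Fin k)
    (a b : Fin n) (T : Finset (Fin L.length)) : ℚ :=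
  ∑ t ∈ T, kM L τ0 a b t

/-- The set `S(L)` of vertices appearing in `L`. -/
def kS {n k : ℕ} (L : List (KMove n k)) : Finset (Fin n) := (L.map Prod.fst).toFinset

/-- The set `C(L)` of cyclic vertices of `L`: vertices over which some cycle of `L` lies. -/
noncomputable def cyclicSet {n k : ℕ} (L : List (KMove n k)) : Finset (Fin n) :=
  Finset.univ.filter (fun v => ∃ T, IsCycle L v T)

/-- The set `A(L)` of acyclic vertices of `L`: vertices of `L` that are not cyclic. -/
noncomputable def acyclicSet {n k : ℕ} (L : List (KMove n k)) : Finset (Fin n) :=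
  kS L \ cyclicSet L

/-- Along a chain whose consecutive elements match up (`t a = s b`), the sum of the increments
`g (t a) - g (s a)` telescopes. -/
theorem List.sum_map_sub_of_isChain {α β M : Type*} [AddCommGroup M] (s t : α → β) (g : β → M)
    (l : List α) (hl : l ≠ []) (hc : l.IsChain (fun a b => t a = s b)) :
    (l.map (fun a => g (t a) - g (s a))).sum = g (t (l.getLast hl)) - g (s (l.head hl)) := by
  induction l with
  | nil => exact absurd rfl hl
  | cons x l ih =>
    cases l with
    | nil => simp
    | cons y l =>
      rw [List.isChain_cons_cons] at hc
      rw [List.map_cons, List.sum_cons, ih (List.cons_ne_nil _ _) hc.2]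
      simp [hc.1]

/-- Over a circuit, the increments of any function of the parts sum to zero. -/
theorem IsCircuit.sum_sub_eq_zero {n k : ℕ} {M : Type*} [AddCommGroup M] {L : List (KMove n k)}
    {u : Fin n} {T : Finset (Fin L.length)} (hT : IsCircuit L u T) (g : Fin k → M) :
    ∑ t ∈ T, (g (L.get t).2.2 - g (L.get t).2.1) = 0 := by
  obtain ⟨hne, -, hchain, hclose⟩ := hT
  have hsort : T.sort (· ≤ ·) ≠ [] := by
    rw [← List.length_pos_iff, Finset.length_sort]
    exact hne.card_pos
  have hsum : ∑ t ∈ T, (g (L.get t).2.2 - g (L.get t).2.1) =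
      ((T.sort (· ≤ ·)).map (fun t => g (L.get t).2.2 - g (L.get t).2.1)).sum := by
    rw [Finset.sum, ← Finset.sort_eq T (· ≤ ·), Multiset.map_coe, Multiset.sum_coe]
  have hclose' := hclose hne
  rw [Finset.max'_eq_sorted_last, Finset.min'_eq_sorted_zero] at hclose'
  rw [hsum, List.sum_map_sub_of_isChain (fun t => (L.get t).2.1) (fun t => (L.get t).2.2) g
    _ hsort hchain, List.getLast_eq_getElem, List.head_eq_getElem, sub_eq_zero]
  exact congrArg g hclose'

/-- Every move of a valid sequence changes the part of the vertex it moves. -/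
theorem kValid.ne_of_mem {n k : ℕ} {L : List (KMove n k)} {τ : Fin n → Fin k}
    (h : kValid τ L) {m : KMove n k} (hm : m ∈ L) : m.2.1 ≠ m.2.2 := by
  induction L generalizing τ with
  | nil => simp at hm
  | cons m' L ih =>
    obtain ⟨-, hne, hrest⟩ := h
    rcases List.mem_cons.mp hm with rfl | hm
    · exact hne
    · exact ih hrest hm

/-- A vertex that no move of `L` touches keeps its part. -/
theorem kRun_apply_of_forall_ne {n k : ℕ} (L : List (KMove n k)) (τ : Fin n → Fin k) (v : Fin n)
    (h : ∀ m ∈ L, v ≠ m.1) : kRun τ L v = τ v := by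
  induction L generalizing τ with
  | nil => rfl
  | cons m L ih =>
    rw [kRun, ih _ fun m' hm' => h m' (List.mem_cons_of_mem _ hm'), kStep,
      Function.update_of_ne (h m List.mem_cons_self)]

/-- non-moving vertices are nullified, max-`k`-cut in arbitrary graphs.
Let `k ≥ 2`, let `G` be a finite simple graph on `n` vertices, and let `L` be a sequence of
moves that is valid from `τ0`. If `v` does not appear in `L`, then
`P_{L,τ0}[{a,v},C] = 0` for every cycle `C ∈ Γ(L)` and every edge `{a,v}` of `G`. -/
theorem nonMoving_nullified_kcut {n k : ℕ} (hk : 2 ≤ k)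
    (G : SimpleGraph (Fin n))
    (L : List (KMove n k)) (τ0 : Fin n → Fin k) (hvalid : kValid τ0 L)
    (v : Fin n) (hv : v ∉ kS L) :
    ∀ a : Fin n, G.Adj a v → ∀ C : KCycle L, kPval L τ0 a v C.1.2 = 0 := by
  rintro a - ⟨⟨u, T⟩, hT, -⟩
  have hfix : ∀ m ∈ L, v ≠ m.1 := by
    rintro m hm rfl
    exact hv (List.mem_toFinset.mpr (List.mem_map_of_mem hm))
  have hconf (t : ℕ) : kConfAt τ0 L t v = τ0 v :=
    kRun_apply_of_forall_ne _ _ _ fun m hm => hfix m (List.mem_of_mem_take hm)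
  have hentry : ∀ t ∈ T, kM L τ0 a v t = if a = u then
      (if (L.get t).2.2 = τ0 v then (1 : ℚ) else 0) - (if (L.get t).2.1 = τ0 v then 1 else 0)
      else 0 := by
    intro t ht
    have hmem := List.get_mem L t
    have hu : (L.get t).1 = u := hT.2.1 t ht
    have hvu : v ≠ u := hu ▸ hfix _ hmem
    have hpq := hvalid.ne_of_mem hmem
    simp only [kM, hconf, hu, hvu, false_and, or_false]
    grind
  rw [kPval, Finset.sum_congr rfl hentry]
  split_ifs with hau
  · exact hT.sum_sub_eq_zero fun q => if q = τ0 v then (1 : ℚ) else 0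
  · exact Finset.sum_const_zero
end

section
/- Fix an integer k ≥ 2, let G=(V,E) be a finite simple graph, and let L be a sequence of moves for max-k-cut that is valid from an initial configuration τ_0 : V → [k]. If H is an L-good, L-neighbor-wise independent directed acyclic graph, then rank(P_{L,τ_0}) ≥ |E(H)|. -/
open Finset MeasureTheory ProbabilityTheory Filter
open scoped Classical

/-- Edges of the graph `G`: ordered pairs `(a,b)` with `a < b` and `a` adjacent to `b`. -/
abbrev gEdge {n : ℕ} (G : SimpleGraph (Fin n)) := {e : Fin n × Fin n // e.1 < e.2 ∧ G.Adj e.1 e.2}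

/-- The matrix `P_{L,τ0}` with rows indexed by the edges of `G` and columns indexed by the
cycles of `L`. -/
noncomputable def kP {n k : ℕ} (G : SimpleGraph (Fin n)) (L : List (KMove n k))
    (τ0 : Fin n → Fin k) : Matrix (gEdge G) (KCycle L) ℚ :=
  fun e c => kPval L τ0 e.1.1 e.1.2 c.1.2

/-- The ordered pair `u v` is an `L`-good-arc: `{u,v}` is an edge of `G` and there is a
cycle `C ∈ Γ(L)` over `u` with `P_{L,τ0}[{u,v},C] ≠ 0`. -/
def kGoodArc {n k : ℕ} (G : SimpleGraph (Fin n)) (L : List (KMove n k))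
    (τ0 : Fin n → Fin k) (u v : Fin n) : Prop :=
  G.Adj u v ∧ ∃ T, IsCycle L u T ∧ kPval L τ0 u v T ≠ 0

/-- The directed graph with arc set `A` (on a subset of the vertices occurring in `L`) is
`L`-good: every arc is an `L`-good-arc. -/
def kLGood {n k : ℕ} (G : SimpleGraph (Fin n)) (L : List (KMove n k)) (τ0 : Fin n → Fin k)
    (A : Finset (Fin n × Fin n)) : Prop :=
  ∀ p ∈ A, p.1 ∈ kS L ∧ p.2 ∈ kS L ∧ kGoodArc G L τ0 p.1 p.2

/-- The directed graph with arc set `A` is `L`-neighbor-wise independent: for every vertex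
`v` there is an ordering `u 0, …, u (m-1)` of the out-neighbors of `v` together with cycles
`C 0, …, C (m-1) ∈ Γ(L)` over `v` such that `P_{L,τ0}[{v,u i}, C i] ≠ 0` and
`P_{L,τ0}[{v,u j}, C i] = 0` for all `j > i`. -/
def kLNbrIndep {n k : ℕ} (L : List (KMove n k)) (τ0 : Fin n → Fin k)
    (A : Finset (Fin n × Fin n)) : Prop :=
  ∀ v : Fin n, ∃ (m : ℕ) (u : Fin m → Fin n) (C : Fin m → Finset (Fin L.length)),
    Function.Injective u ∧
    (∀ w : Fin n, (v, w) ∈ A ↔ ∃ i, u i = w) ∧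
    (∀ i, IsCycle L v (C i)) ∧
    (∀ i, kPval L τ0 v (u i) (C i) ≠ 0) ∧
    (∀ i j, i < j → kPval L τ0 v (u j) (C i) = 0)

/-- A finite directed graph without closed walks admits a topological numbering. -/
theorem IsDAG.exists_topological_numbering {α : Type*} [Fintype α] {A : Finset (α × α)}
    (hA : IsDAG A) : ∃ f : α → ℕ, ∀ v w, (v, w) ∈ A → f v < f w := by
  set R : α → α → Prop := fun a b => (a, b) ∈ A with hR
  have hirr : ∀ v, ¬ Relation.TransGen R v v := by
    intro v hv
    obtain ⟨w, hvw, hwv⟩ := Relation.TransGen.tail'_iff.mp hv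
    obtain ⟨l, hl, hlast⟩ := List.exists_isChain_cons_of_relationReflTransGen hvw
    refine hA v l hl ?_
    have : l.getLastD v = w := by
      rw [← hlast]
      cases l <;> simp [List.getLastD]
    rw [this]
    exact hwv
  refine ⟨fun v => (univ.filter fun u => Relation.TransGen R u v).card, fun v w hvw => ?_⟩
  refine card_lt_card ((ssubset_iff_of_subset fun u hu => ?_).mpr ⟨v, ?_, ?_⟩)
  · simp only [mem_filter, mem_univ, true_and] at hu ⊢
    exact hu.tail hvw
  · simpa using Relation.TransGen.single hvw
  · simpa using hirr v

/-- If some square selection of rows and columns of `M` is triangular for a linearly ordered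
labelling, with nonzero diagonal, then its size bounds the rank of `M` from below. -/
theorem Matrix.card_le_rank_of_triangular {ι m n K β : Type*} [Fintype ι] [Fintype m] [Fintype n]
    [Field K] [LinearOrder β] (M : Matrix m n K) (r : ι → m) (c : ι → n) (f : ι → β)
    (hdiag : ∀ i, M (r i) (c i) ≠ 0)
    (htri : ∀ i j, M (r i) (c j) ≠ 0 → i = j ∨ f i < f j) :
    Fintype.card ι ≤ M.rank := by
  have hli : LinearIndependent K fun j => M.col (c j) := by
    rw [Fintype.linearIndependent_iff]
    intro x hx
    by_contra! hne
    obtain ⟨i, hi⟩ := hne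
    obtain ⟨j, hj, hmax⟩ := exists_max_image (univ.filter fun i => x i ≠ 0) f ⟨i, by simpa using hi⟩
    simp only [mem_filter, mem_univ, true_and] at hj hmax
    have hrow := congrFun hx (r j)
    simp only [Finset.sum_apply, Pi.smul_apply, Matrix.col_apply, smul_eq_mul,
      Pi.zero_apply] at hrow
    rw [Finset.sum_eq_single j] at hrow
    · exact (mul_ne_zero hj (hdiag j)) hrow
    · intro l _ hlj
      by_contra hl
      rcases htri j l (right_ne_zero_of_mul hl) with h | h
      · exact hlj h.symm
      · exact (hmax l (left_ne_zero_of_mul hl)).not_gt h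
    · simp
  rw [Matrix.rank_eq_finrank_span_cols, ← finrank_span_eq_card hli]
  exact Submodule.finrank_mono (Submodule.span_mono (by rintro _ ⟨j, rfl⟩; exact ⟨c j, rfl⟩))

theorem kM_comm {n k : ℕ} (L : List (KMove n k)) (τ0 : Fin n → Fin k) (a b : Fin n)
    (t : Fin L.length) : kM L τ0 a b t = kM L τ0 b a t := by
  unfold kM
  congr 1
  · exact propext or_comm
  · congr 1
    exact propext or_comm

theorem kPval_comm {n k : ℕ} (L : List (KMove n k)) (τ0 : Fin n → Fin k) (a b : Fin n)
    (T : Finset (Fin L.length)) : kPval L τ0 a b T = kPval L τ0 b a T :=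
  sum_congr rfl fun t _ => kM_comm L τ0 a b t

/-- Cycles over a vertex only affect the edges incident to that vertex. -/
theorem IsCycle.mem_edge_of_kPval_ne_zero {n k : ℕ} {L : List (KMove n k)} {τ0 : Fin n → Fin k}
    {a b v : Fin n} {T : Finset (Fin L.length)} (hT : IsCycle L v T)
    (h : kPval L τ0 a b T ≠ 0) : v = a ∨ v = b := by
  obtain ⟨t, ht, hne⟩ := exists_ne_zero_of_sum_ne_zero h
  have hv := hT.1.2.1 t ht
  by_contra! hab
  apply hne
  unfold kM
  rw [hv]
  simp [hab.1.symm, hab.2.symm]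

theorem exists_gEdge_kP_eq {n k : ℕ} {G : SimpleGraph (Fin n)} (L : List (KMove n k))
    (τ0 : Fin n → Fin k) {a b : Fin n} (h : G.Adj a b) :
    ∃ e : gEdge G, ∀ c : KCycle L, kP G L τ0 e c = kPval L τ0 a b c.1.2 := by
  rcases lt_or_gt_of_ne h.ne with hlt | hlt
  · exact ⟨⟨(a, b), hlt, h⟩, fun c => rfl⟩
  · exact ⟨⟨(b, a), hlt, h.symm⟩, fun c => kPval_comm L τ0 b a c.1.2⟩

/-- rank lower bound from an `L`-good `L`-neighbor-wise independent DAG,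
max-`k`-cut in arbitrary graphs. -/
theorem rank_ge_of_good_nbrIndep_dag_kcut {n k : ℕ} (hk : 2 ≤ k)
    (G : SimpleGraph (Fin n))
    (L : List (KMove n k)) (τ0 : Fin n → Fin k) (hvalid : kValid τ0 L)
    (A : Finset (Fin n × Fin n))
    (hgood : kLGood G L τ0 A) (hindep : kLNbrIndep L τ0 A) (hdag : IsDAG A) :
    A.card ≤ (kP G L τ0).rank := by
  obtain ⟨f, hf⟩ := hdag.exists_topological_numbering
  choose m u C _ hnbr hcyc hne hzero using hindep
  have hidx : ∀ p : A, ∃ i, u p.1.1 i = p.1.2 := fun p => (hnbr p.1.1 p.1.2).mp p.2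
  choose idx hu using hidx
  choose row hrow using fun p : A => exists_gEdge_kP_eq L τ0 (hgood p.1 p.2).2.2.1
  let col : A → KCycle L := fun p => ⟨(p.1.1, C p.1.1 (idx p)), hcyc _ _⟩
  rw [← Fintype.card_coe A]
  refine Matrix.card_le_rank_of_triangular (kP G L τ0) row col
    (fun p => toLex (f p.1.1, (idx p : ℕ))) (fun p => ?_) (fun p q hpq => ?_)
  · rw [hrow, ← hu]
    exact hne _ _
  · rw [hrow] at hpq
    obtain ⟨⟨v, w⟩, hp⟩ := p
    obtain ⟨⟨v', w'⟩, hq⟩ := q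
    rcases (hcyc _ _).mem_edge_of_kPval_ne_zero hpq with h | h
    · obtain rfl : v' = v := h
      have hle : idx ⟨(v', w), hp⟩ ≤ idx ⟨(v', w'), hq⟩ := by
        by_contra! hlt
        refine hpq ?_
        have := hzero v' _ _ hlt
        rwa [hu ⟨(v', w), hp⟩] at this
      rcases hle.eq_or_lt with heq | hlt
      · left
        have hw := hu ⟨(v', w), hp⟩
        rw [heq] at hw
        obtain rfl : w' = w := (hu ⟨(v', w'), hq⟩).symm.trans hw
        rfl
      · right
        exact Prod.Lex.toLex_lt_toLex.mpr (Or.inr ⟨rfl, hlt⟩)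
    · right
      obtain rfl : v' = w := h
      exact Prod.Lex.toLex_lt_toLex.mpr (Or.inl (hf _ _ hp))
end

section
/- Let k = 3, let G=(V,E) be a finite simple graph, and let L be a sequence of moves for max-3-cut that is valid from an initial configuration τ_0 : V → [3]. Let t_1 < t_2 < t_3 be time steps at which a vertex v moves such that t_1, t_2 and t_3 belong to three different cyclic blocks of L, and let t_3' be the last time step at which v moves in the cyclic block containing t_3. Then there exists a cycle C ∈ Γ(L) over v such that (i) C is a leaping cycle, and (ii) every t ∈ T(C) satisfies t_1 ≤ t ≤ t_3'. -/
open Finset MeasureTheory ProbabilityTheory Filter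
open scoped Classical

/-- Position `t` of `L` holds a move of a cyclic vertex of `L`. -/
def cycPos {n k : ℕ} (L : List (KMove n k)) (t : ℕ) : Prop :=
  ∃ m, L[t]? = some m ∧ m.1 ∈ cyclicSet L

/-- The interval of positions `[i,j]` is a cyclic block of `L`: a maximal block of `L`
consisting only of cyclic vertices of `L`. -/
def IsCycBlock {n k : ℕ} (L : List (KMove n k)) (i j : ℕ) : Prop :=
  i ≤ j ∧ j < L.length ∧ (∀ t, i ≤ t → t ≤ j → cycPos L t) ∧
  (i = 0 ∨ ¬ cycPos L (i - 1)) ∧ ¬ cycPos L (j + 1)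

/-- A set `T` of time steps of `L` is leaping if its elements meet at least two distinct
cyclic blocks of `L`. -/
def Leaping {n k : ℕ} (L : List (KMove n k)) (T : Finset (Fin L.length)) : Prop :=
  ∃ i1 j1 i2 j2 : ℕ, IsCycBlock L i1 j1 ∧ IsCycBlock L i2 j2 ∧ (i1, j1) ≠ (i2, j2) ∧
    (∃ t ∈ T, i1 ≤ (t : ℕ) ∧ (t : ℕ) ≤ j1) ∧ (∃ t ∈ T, i2 ≤ (t : ℕ) ∧ (t : ℕ) ≤ j2)

theorem kConfAt_spec {n k : ℕ} {L : List (KMove n k)} {τ : Fin n → Fin k}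
    (h : kValid τ L) (t : Fin L.length) :
    kConfAt τ L t (L.get t).1 = (L.get t).2.1 ∧ (L.get t).2.1 ≠ (L.get t).2.2 ∧
      kConfAt τ L (t + 1) = kStep (kConfAt τ L t) (L.get t) := by
  induction L generalizing τ with
  | nil => exact t.elim0
  | cons m L ih =>
    obtain ⟨h1, h2, h3⟩ := h
    refine Fin.cases ?_ (fun s => ?_) t
    · exact ⟨h1, h2, by simp [kConfAt, kRun]⟩
    · exact ih h3 s

theorem exists_isCycBlock_of_cycPos {n k : ℕ} {L : List (KMove n k)} {t : ℕ}
    (h : cycPos L t) : ∃ i j, IsCycBlock L i j ∧ i ≤ t ∧ t ≤ j := by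
  have lt_length : ∀ s, cycPos L s → s < L.length := by
    rintro s ⟨m, hm, -⟩
    exact (List.getElem?_eq_some_iff.1 hm).1
  have hright : ∃ j, t ≤ j ∧ ¬ cycPos L (j + 1) :=
    ⟨L.length, (lt_length t h).le, fun hc => by have := lt_length _ hc; omega⟩
  have hleft : ∃ i, i ≤ t ∧ ∀ s, i ≤ s → s ≤ t → cycPos L s :=
    ⟨t, le_rfl, fun s h1 h2 => le_antisymm h1 h2 ▸ h⟩
  obtain ⟨hi, hi'⟩ := Nat.find_spec hleft
  obtain ⟨hj, hj'⟩ := Nat.find_spec hright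
  have himin := fun m => Nat.find_min (m := m) hleft
  have hjmin := fun m => Nat.find_min (m := m) hright
  generalize Nat.find hleft = i at *
  generalize Nat.find hright = j at *
  have hall : ∀ s, t ≤ s → s ≤ j → cycPos L s := by
    intro s hs
    induction s, hs using Nat.le_induction with
    | base => exact fun _ => h
    | succ s hs _ =>
      intro hsj
      by_contra hc
      exact hjmin s hsj ⟨hs, hc⟩
  refine ⟨i, j, ⟨hi.trans hj, lt_length j (hall j hj le_rfl), fun s h1 h2 => ?_, ?_, hj'⟩, hi, hj⟩
  · rcases le_total s t with hs | hs
    · exact hi' s h1 hs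
    · exact hall s hs h2
  · by_contra! hc
    refine himin (i - 1) (by omega) ⟨by omega, fun s h1 h2 => ?_⟩
    rcases Nat.lt_or_ge s i with hs | hs
    · rw [show s = i - 1 by omega]
      exact hc.2
    · exact hi' s hs h2

/-- Time steps of `T` separated by a position that is not cyclic make `T` leaping. -/
theorem leaping_of_gap {n k : ℕ} {L : List (KMove n k)} {T : Finset (Fin L.length)}
    {a b : Fin L.length} {g : ℕ} (ha : a ∈ T) (hb : b ∈ T)
    (hca : cycPos L a) (hcb : cycPos L b) (hag : (a : ℕ) < g) (hgb : g < b)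
    (hg : ¬ cycPos L g) : Leaping L T := by
  obtain ⟨i, j, hB, h1, h2⟩ := exists_isCycBlock_of_cycPos hca
  obtain ⟨i', j', hB', h1', h2'⟩ := exists_isCycBlock_of_cycPos hcb
  refine ⟨i, j, i', j', hB, hB', fun he => hg ?_, ⟨a, ha, h1, h2⟩, ⟨b, hb, h1', h2'⟩⟩
  obtain ⟨-, rfl⟩ := Prod.mk.inj he
  exact hB.2.2.1 g (by omega) (by omega)

/-- Of two distinct cyclic blocks, the one holding the earlier position is followed by a
noncyclic position preceding every position of the other. -/
theorem IsCycBlock.succ_lt_of_lt {n k : ℕ} {L : List (KMove n k)} {i j i' j' s t : ℕ}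
    (hB : IsCycBlock L i j) (hB' : IsCycBlock L i' j') (hne : (i, j) ≠ (i', j'))
    (hs : i ≤ s ∧ s ≤ j) (ht : i' ≤ t ∧ t ≤ j') (hst : s < t) : j + 1 < t := by
  obtain ⟨h1, h2, h3, h4, h5⟩ := hB
  obtain ⟨h1', h2', h3', h4', h5'⟩ := hB'
  by_contra! hc
  have hjt : t ≠ j + 1 := by
    rintro rfl
    exact h5 (h3' _ ht.1 ht.2)
  have hj : j = j' := by
    rcases lt_trichotomy j j' with h | h | h
    · exact absurd (h3' (j + 1) (by omega) h) h5
    · exact h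
    · exact absurd (h3 (j' + 1) (by omega) h) h5'
  have hi : i = i' := by
    rcases lt_trichotomy i i' with h | h | h
    · rcases h4' with h0 | h0
      · omega
      · exact absurd (h3 (i' - 1) (by omega) (by omega)) h0
    · exact h
    · rcases h4 with h0 | h0
      · omega
      · exact absurd (h3' (i - 1) (by omega) (by omega)) h0
  exact hne (by rw [hi, hj])

theorem isCycle_pair {n k : ℕ} {L : List (KMove n k)} {v : Fin n} {a b : Fin L.length}
    (hab : a < b) (ha : (L.get a).1 = v) (hb : (L.get b).1 = v)
    (hna : (L.get a).2.1 ≠ (L.get a).2.2) (h1 : (L.get a).2.2 = (L.get b).2.1)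
    (h2 : (L.get b).2.2 = (L.get a).2.1) : IsCycle L v {a, b} := by
  have hsort : Finset.sort ({a, b} : Finset (Fin L.length)) (· ≤ ·) = [a, b] := by
    have := (List.toFinset_sort (l := [a, b]) (· ≤ ·) (by simp [hab.ne])).2
      (by simp [hab.le])
    simpa using this
  refine ⟨⟨by simp, by simpa using ⟨ha, hb⟩, ?_, fun h => ?_⟩, fun T hT hc => ?_⟩
  · rw [hsort]
    exact List.isChain_pair.2 h1
  · have hmax : ({a, b} : Finset (Fin L.length)).max' h = b :=
      (Finset.max'_eq_iff _ _ _).2 (by simp [hab.le])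
    have hmin : ({a, b} : Finset (Fin L.length)).min' h = a :=
      (Finset.min'_eq_iff _ _ _).2 (by simp [hab.le])
    rw [hmax, hmin, h2]
  · obtain ⟨hT1, hT2⟩ := Finset.ssubset_def.1 hT
    obtain ⟨hne, -, -, hcl⟩ := hc
    have hcl := hcl hne
    have hM := Finset.max'_mem T hne
    have hm := Finset.min'_mem T hne
    have hle := Finset.min'_le T _ hM
    generalize T.max' hne = M at *
    generalize T.min' hne = m at *
    have hM' := hT1 hM
    have hm' := hT1 hm
    simp only [Finset.mem_insert, Finset.mem_singleton] at hM' hm'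
    rcases hM' with rfl | rfl <;> rcases hm' with rfl | rfl
    · exact hna hcl.symm
    · exact absurd hle (not_le.2 hab)
    · exact hT2 (by simp [Finset.insert_subset_iff, hM, hm])
    · exact hna (by rw [← h2, hcl, h1])

theorem isCycle_triple {n k : ℕ} {L : List (KMove n k)} {v : Fin n} {a b c : Fin L.length}
    (hab : a < b) (hbc : b < c) (ha : (L.get a).1 = v) (hb : (L.get b).1 = v)
    (hc : (L.get c).1 = v)
    (hna : (L.get a).2.1 ≠ (L.get a).2.2) (hnb : (L.get b).2.1 ≠ (L.get b).2.2)
    (hnc : (L.get c).2.1 ≠ (L.get c).2.2) (h1 : (L.get a).2.2 = (L.get b).2.1)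
    (h2 : (L.get b).2.2 = (L.get c).2.1) (h3 : (L.get c).2.2 = (L.get a).2.1) :
    IsCycle L v {a, b, c} := by
  have hac := hab.trans hbc
  have hsort : Finset.sort ({a, b, c} : Finset (Fin L.length)) (· ≤ ·) = [a, b, c] := by
    have := (List.toFinset_sort (l := [a, b, c]) (· ≤ ·)
      (by simp [hab.ne, hbc.ne, hac.ne])).2 (by simp [hab.le, hbc.le, hac.le])
    simpa using this
  refine ⟨⟨by simp, by simpa using ⟨ha, hb, hc⟩, ?_, fun h => ?_⟩, fun T hT hcirc => ?_⟩
  · rw [hsort]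
    exact List.isChain_cons_cons.2 ⟨h1, List.isChain_pair.2 h2⟩
  · have hmax : ({a, b, c} : Finset (Fin L.length)).max' h = c :=
      (Finset.max'_eq_iff _ _ _).2 (by simp [hac.le, hbc.le])
    have hmin : ({a, b, c} : Finset (Fin L.length)).min' h = a :=
      (Finset.min'_eq_iff _ _ _).2 (by simp [hac.le, hab.le])
    rw [hmax, hmin, h3]
  · obtain ⟨hT1, hT2⟩ := Finset.ssubset_def.1 hT
    obtain ⟨hne, -, hch, hcl⟩ := hcirc
    have hcl := hcl hne
    have hM := Finset.max'_mem T hne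
    have hm := Finset.min'_mem T hne
    have hle := Finset.min'_le T _ hM
    generalize T.max' hne = M at *
    generalize T.min' hne = m at *
    have hM' := hT1 hM
    have hm' := hT1 hm
    have key : a ∈ T → c ∈ T → False := by
      intro haT hcT
      have hbT : b ∉ T := fun hbT => hT2 (by simp [Finset.insert_subset_iff, haT, hbT, hcT])
      have hT : T = {a, c} := by
        ext x
        refine ⟨fun hx => ?_, fun hx => ?_⟩
        · have := hT1 hx
          simp only [Finset.mem_insert, Finset.mem_singleton] at this ⊢
          rcases this with h | rfl | h
          · exact .inl h
          · exact absurd hx hbT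
          · exact .inr h
        · simp only [Finset.mem_insert, Finset.mem_singleton] at hx
          rcases hx with rfl | rfl <;> assumption
      have hsort' : Finset.sort T (· ≤ ·) = [a, c] := by
        have := (List.toFinset_sort (l := [a, c]) (· ≤ ·) (by simp [hac.ne])).2
          (by simp [hac.le])
        rw [hT]
        simpa using this
      rw [hsort'] at hch
      have : (L.get a).2.2 = (L.get c).2.1 :=
        (List.isChain_pair (R := fun a b => (L.get a).2.2 = (L.get b).2.1)).1 hch
      exact hnb (by rw [h2, ← h1, this])
    simp only [Finset.mem_insert, Finset.mem_singleton] at hM' hm'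
    rcases hM' with rfl | rfl | rfl <;> rcases hm' with rfl | rfl | rfl
    · exact hna hcl.symm
    · exact absurd hle (not_le.2 hab)
    · exact absurd hle (not_le.2 hac)
    · exact hnc (by rw [← h2, hcl, h3])
    · exact hnb hcl.symm
    · exact absurd hle (not_le.2 hbc)
    · exact key hm hM
    · exact hna (by rw [← h3, hcl, h1])
    · exact hnc hcl.symm

/-- The last element before `g` of a predicate holding somewhere before `g`. -/
theorem Nat.exists_last_lt {P : ℕ → Prop} {t g : ℕ} (ht : P t) (htg : t < g) :
    ∃ a, t ≤ a ∧ a < g ∧ P a ∧ ∀ s, a < s → s < g → ¬ P s := by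
  have h : ∃ d, d < g ∧ P (g - 1 - d) := ⟨g - 1 - t, by omega, by
    rwa [show g - 1 - (g - 1 - t) = t by omega]⟩
  refine ⟨g - 1 - Nat.find h, ?_, by omega, (Nat.find_spec h).2, fun s h1 h2 hs => ?_⟩
  · have := Nat.find_min' h (m := g - 1 - t) ⟨by omega, by
      rwa [show g - 1 - (g - 1 - t) = t by omega]⟩
    omega
  · have := Nat.find_min' h (m := g - 1 - s) ⟨by omega, by
      rwa [show g - 1 - (g - 1 - s) = s by omega]⟩
    have := (Nat.find_spec h).1
    omega

/-- The first time after `g` at which a predicate failing at `g` begins to hold. -/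
theorem Nat.exists_first_succ {P : ℕ → Prop} {g u : ℕ} (hg : ¬ P g) (hgu : g ≤ u) (hu : P u) :
    ∃ w, g ≤ w ∧ w < u ∧ P (w + 1) ∧ ∀ s, g ≤ s → s ≤ w → ¬ P s := by
  have h : ∃ x, g ≤ x ∧ P x := ⟨u, hgu, hu⟩
  obtain ⟨h1, h2⟩ := Nat.find_spec h
  have hle := Nat.find_min' h ⟨hgu, hu⟩
  have hmin := fun m => Nat.find_min (m := m) h
  generalize Nat.find h = x at *
  have hx : x ≠ g := by
    rintro rfl
    exact hg h2
  refine ⟨x - 1, by omega, by omega, by rwa [show x - 1 + 1 = x by omega], fun s hs hsx hP => ?_⟩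
  exact hmin s (by omega) ⟨hs, hP⟩

theorem eq_of_forall_succ_eq {α : Type*} {c : ℕ → α} {a b : ℕ} (hab : a ≤ b)
    (h : ∀ s, a ≤ s → s < b → c (s + 1) = c s) : c b = c a := by
  induction b, hab using Nat.le_induction with
  | base => rfl
  | succ b hb ih =>
    rw [h b hb (by omega), ih fun s h1 h2 => h s h1 (by omega)]

/-- existence of leaping cycles, max-3-cut.
Let `L` be a valid sequence from `τ0` and let `t1 < t2 < t3` be time steps at which `v`
moves, lying in three distinct cyclic blocks of `L`, and let `t3'` be the last time step at
which `v` moves within the cyclic block containing `t3`. Then there exists a leaping cycle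
`C ∈ Γ(L)` over `v` all of whose time steps `t` satisfy `t1 ≤ t ≤ t3'`. -/
theorem exists_leaping_cycle {n : ℕ} (G : SimpleGraph (Fin n))
    (L : List (KMove n 3)) (τ0 : Fin n → Fin 3) (hvalid : kValid τ0 L)
    (v : Fin n) (t1 t2 t3 t3' : Fin L.length)
    (h12 : t1 < t2) (h23 : t2 < t3)
    (hv1 : (L.get t1).1 = v) (hv2 : (L.get t2).1 = v) (hv3 : (L.get t3).1 = v)
    (i1 j1 i2 j2 i3 j3 : ℕ)
    (hB1 : IsCycBlock L i1 j1) (hB2 : IsCycBlock L i2 j2) (hB3 : IsCycBlock L i3 j3)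
    (hne12 : (i1, j1) ≠ (i2, j2)) (hne23 : (i2, j2) ≠ (i3, j3)) (hne13 : (i1, j1) ≠ (i3, j3))
    (ht1 : i1 ≤ (t1 : ℕ) ∧ (t1 : ℕ) ≤ j1)
    (ht2 : i2 ≤ (t2 : ℕ) ∧ (t2 : ℕ) ≤ j2)
    (ht3 : i3 ≤ (t3 : ℕ) ∧ (t3 : ℕ) ≤ j3)
    (ht3' : i3 ≤ (t3' : ℕ) ∧ (t3' : ℕ) ≤ j3) (hv3' : (L.get t3').1 = v)
    (hlast : ∀ t : Fin L.length, i3 ≤ (t : ℕ) → (t : ℕ) ≤ j3 → (L.get t).1 = v → t ≤ t3') :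
    ∃ T : Finset (Fin L.length), IsCycle L v T ∧ Leaping L T ∧
      ∀ t ∈ T, t1 ≤ t ∧ t ≤ t3' := by
  have hcyc : v ∈ cyclicSet L := by
    obtain ⟨m, hm, hmc⟩ := hB1.2.2.1 t1 ht1.1 ht1.2
    have : L.get t1 = m := by simpa using hm
    rwa [← hv1, this]
  have hpos : ∀ t : Fin L.length, (L.get t).1 = v → cycPos L t := fun t ht =>
    ⟨L.get t, by simp, by rwa [ht]⟩
  have hg1 := hB1.2.2.2.2
  have hg2 := hB2.2.2.2.2
  have ht1g : (t1 : ℕ) < j1 + 1 := by omega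
  have hgt2 : j1 + 1 < (t2 : ℕ) := hB1.succ_lt_of_lt hB2 hne12 ht1 ht2 h12
  have ht2g : (t2 : ℕ) < j2 + 1 := by omega
  have hgt3 : j2 + 1 < (t3 : ℕ) := hB2.succ_lt_of_lt hB3 hne23 ht2 ht3 h23
  have ht33 : t3 ≤ t3' := hlast t3 ht3.1 ht3.2 hv3
  generalize j1 + 1 = g1 at *
  generalize j2 + 1 = g2 at *
  -- The part of `v` over time, and the times at which `v` moves.
  obtain ⟨c, hc⟩ : ∃ c : ℕ → Fin 3, ∀ t, c t = kConfAt τ0 L t v := ⟨_, fun _ => rfl⟩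
  obtain ⟨P, hP⟩ : ∃ P : ℕ → Prop, ∀ t, P t ↔ ∃ h : t < L.length, (L.get ⟨t, h⟩).1 = v :=
    ⟨_, fun _ => Iff.rfl⟩
  have hmove : ∀ t (h : t < L.length), (L.get ⟨t, h⟩).1 = v →
      (L.get ⟨t, h⟩).2.1 = c t ∧ (L.get ⟨t, h⟩).2.2 = c (t + 1) ∧ c t ≠ c (t + 1) := by
    intro t h hv
    obtain ⟨h1, h2, h3⟩ := kConfAt_spec hvalid ⟨t, h⟩
    have h4 : (L.get ⟨t, h⟩).2.1 = c t := by rw [← h1, hv, hc]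
    have h5 : (L.get ⟨t, h⟩).2.2 = c (t + 1) := by
      rw [hc, h3, kStep, hv, Function.update_self]
    exact ⟨h4, h5, h4 ▸ h5 ▸ h2⟩
  have hstay : ∀ t, t < L.length → ¬ P t → c (t + 1) = c t := by
    intro t h hv
    obtain ⟨-, -, h3⟩ := kConfAt_spec hvalid ⟨t, h⟩
    rw [hc, hc, h3, kStep, Function.update_of_ne]
    exact fun he => hv ((hP t).2 ⟨h, he.symm⟩)
  have hPg : ∀ g, ¬ cycPos L g → ¬ P g := by
    intro g hg hPg
    obtain ⟨h, hv⟩ := (hP g).1 hPg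
    exact hg (hpos ⟨g, h⟩ hv)
  have hlen := t3.isLt
  have h33 : (t3 : ℕ) ≤ t3' := ht33
  have pair : ∀ a b g, P a → P b → a < g → g < b → ¬ cycPos L g → (t1 : ℕ) ≤ a →
      b ≤ t3 → c (a + 1) = c b → c (b + 1) = c a →
      ∃ T : Finset (Fin L.length), IsCycle L v T ∧ Leaping L T ∧ ∀ t ∈ T, t1 ≤ t ∧ t ≤ t3' := by
    intro a b g hPa hPb hag hgb hg hta hbt h1 h2
    obtain ⟨hal, hav⟩ := (hP a).1 hPa
    obtain ⟨hbl, hbv⟩ := (hP b).1 hPb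
    obtain ⟨ha1, ha2, ha3⟩ := hmove a hal hav
    obtain ⟨hb1, hb2, hb3⟩ := hmove b hbl hbv
    refine ⟨{⟨a, hal⟩, ⟨b, hbl⟩}, isCycle_pair (Fin.lt_def.2 (hag.trans hgb)) hav hbv ?_ ?_ ?_,
      leaping_of_gap (g := g) (a := ⟨a, hal⟩) (b := ⟨b, hbl⟩) (by simp) (by simp)
        (hpos _ hav) (hpos _ hbv) hag hgb hg, ?_⟩
    · rwa [ha1, ha2]
    · rwa [ha2, hb1]
    · rwa [hb2, ha1]
    · simp only [Finset.mem_insert, Finset.mem_singleton, Fin.le_def]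
      rintro t (rfl | rfl)
      · exact ⟨hta, (by omega : a ≤ t3')⟩
      · exact ⟨(by omega : (t1 : ℕ) ≤ b), (by omega : b ≤ t3')⟩
  obtain ⟨a, hta, hag, hPa, ha_last⟩ :=
    Nat.exists_last_lt (P := P) ((hP t1).2 ⟨t1.isLt, hv1⟩) ht1g
  obtain ⟨hal, hav⟩ := (hP a).1 hPa
  obtain ⟨ha1, ha2, ha3⟩ := hmove a hal hav
  have hcg1 : c g1 = c (a + 1) :=
    eq_of_forall_succ_eq (by omega) fun s h1 h2 => hstay s (by omega) (ha_last s (by omega) h2)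
  by_cases hret : ∃ u, g1 ≤ u ∧ u ≤ t3 + 1 ∧ c u = c a
  · obtain ⟨u, hu1, hu2, hu3⟩ := hret
    obtain ⟨w, hw1, hw2, hw3, hw4⟩ := Nat.exists_first_succ (P := fun s => c s = c a)
      (fun h => ha3 (h.symm.trans hcg1)) hu1 hu3
    have hPw : P w := by
      by_contra hn
      exact hw4 w hw1 le_rfl ((hstay w (by omega) hn).symm.trans hw3)
    have hgw : g1 < w := lt_of_le_of_ne hw1 fun h => hPg g1 hg1 (h ▸ hPw)
    by_cases hcw : c w = c (a + 1)
    · exact pair a w g1 hPa hPw hag hgw hg1 hta (by omega) hcw.symm hw3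
    · obtain ⟨s, hs1, hs2, hs3, hs4⟩ := Nat.exists_first_succ (P := fun s => c s = c w)
        (fun h => hcw (h.symm.trans hcg1)) hw1 rfl
      have hcs : c s = c (a + 1) := by
        have h1 := hs4 s hs1 le_rfl
        have h2 := hw4 s hs1 (by omega)
        have h3 := hw4 w hw1 le_rfl
        omega
      have hPs : P s := by
        by_contra hn
        exact hs4 s hs1 le_rfl ((hstay s (by omega) hn).symm.trans hs3)
      obtain ⟨hsl, hsv⟩ := (hP s).1 hPs
      obtain ⟨hwl, hwv⟩ := (hP w).1 hPw
      obtain ⟨hs5, hs6, hs7⟩ := hmove s hsl hsv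
      obtain ⟨hw5, hw6, hw7⟩ := hmove w hwl hwv
      refine ⟨{⟨a, hal⟩, ⟨s, hsl⟩, ⟨w, hwl⟩}, isCycle_triple (Fin.lt_def.2 (hag.trans_le hs1))
        (Fin.lt_def.2 hs2) hav hsv hwv ?_ ?_ ?_ ?_ ?_ ?_,
        leaping_of_gap (g := g1) (a := ⟨a, hal⟩) (b := ⟨w, hwl⟩) (by simp) (by simp)
          (hpos _ hav) (hpos _ hwv) hag hgw hg1, ?_⟩
      · rwa [ha1, ha2]
      · rwa [hs5, hs6]
      · rwa [hw5, hw6]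
      · rw [ha2, hs5, hcs]
      · rwa [hs6, hw5]
      · rwa [hw6, ha1]
      · simp only [Finset.mem_insert, Finset.mem_singleton, Fin.le_def]
        rintro t (rfl | rfl | rfl)
        · exact ⟨hta, (by omega : a ≤ t3')⟩
        · exact ⟨(by omega : (t1 : ℕ) ≤ s), (by omega : s ≤ t3')⟩
        · exact ⟨(by omega : (t1 : ℕ) ≤ w), (by omega : w ≤ t3')⟩
  · push Not at hret
    obtain ⟨b, htb, hbg, hPb, hb_last⟩ :=
      Nat.exists_last_lt (P := P) ((hP t2).2 ⟨t2.isLt, hv2⟩) ht2g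
    obtain ⟨w, hw1, hw2, hPe, hw4⟩ := Nat.exists_first_succ (P := P) (hPg g2 hg2) hgt3.le
      ((hP t3).2 ⟨t3.isLt, hv3⟩)
    have hce : c (w + 1) = c (b + 1) := by
      refine eq_of_forall_succ_eq (by omega) fun s h1 h2 => hstay s (by omega) ?_
      rcases Nat.lt_or_ge s g2 with h | h
      · exact hb_last s (by omega) h
      · exact hw4 s h (by omega)
    obtain ⟨hbl, hbv⟩ := (hP b).1 hPb
    obtain ⟨hel, hev⟩ := (hP (w + 1)).1 hPe
    have h1 := (hmove b hbl hbv).2.2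
    have h2 := (hmove (w + 1) hel hev).2.2
    have h3 := hret b (by omega) (by omega)
    have h4 := hret (b + 1) (by omega) (by omega)
    have h5 := hret (w + 1 + 1) (by omega) (by omega)
    exact pair b (w + 1) g2 hPb hPe hbg (by omega) hg2 (by omega) (by omega) hce.symm (by omega)
end

section
/- Let k = 3 and let G=(V,E) be the complete graph on n vertices. Let L be a sequence of moves for max-3-cut that is valid from an initial configuration τ_0 : V → [3], and let C ∈ Γ(L) be a leaping cycle over a vertex v that is not tricky. Then there exists a vertex u ∈ A(L) ∩ S(L[t_beg(C), t_end(C)]) such that the ordered pair vu is an L-good-arc. -/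
open Finset MeasureTheory ProbabilityTheory Filter
open scoped Classical

/-- `S(L[a,b])`: the set of vertices moving at some time step `s` with `a ≤ s ≤ b`. -/
noncomputable def segS {n k : ℕ} (L : List (KMove n k)) (a b : ℕ) : Finset (Fin n) :=
  Finset.univ.filter (fun u => ∃ t, a ≤ t ∧ t ≤ b ∧ ∃ m, L[t]? = some m ∧ m.1 = u)

/-- A set `T` of time steps of `L` is tricky: it is a leaping 3-cycle whose three time steps
`t < t' < t''` lie in three distinct cyclic blocks of `L` and such that
`A(L) ∩ S(L[t,t']) = A(L) ∩ S(L[t',t''])`. -/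
def Tricky {n k : ℕ} (L : List (KMove n k)) (T : Finset (Fin L.length)) : Prop :=
  ∃ t t' t'' : Fin L.length, t < t' ∧ t' < t'' ∧ T = {t, t', t''} ∧
    (∃ i1 j1 i2 j2 i3 j3 : ℕ,
      IsCycBlock L i1 j1 ∧ IsCycBlock L i2 j2 ∧ IsCycBlock L i3 j3 ∧
      (i1, j1) ≠ (i2, j2) ∧ (i2, j2) ≠ (i3, j3) ∧ (i1, j1) ≠ (i3, j3) ∧
      i1 ≤ (t : ℕ) ∧ (t : ℕ) ≤ j1 ∧ i2 ≤ (t' : ℕ) ∧ (t' : ℕ) ≤ j2 ∧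
      i3 ≤ (t'' : ℕ) ∧ (t'' : ℕ) ≤ j3) ∧
    acyclicSet L ∩ segS L (t : ℕ) (t' : ℕ) = acyclicSet L ∩ segS L (t' : ℕ) (t'' : ℕ)

/-- The ordered pair `v u` is an `L`-good-arc (complete graph): `u ≠ v` and there is a cycle
`C ∈ Γ(L)` over `v` with `P_{L,τ0}[{u,v},C] ≠ 0`. -/
def k3GoodArc {n k : ℕ} (L : List (KMove n k)) (τ0 : Fin n → Fin k) (v u : Fin n) : Prop :=
  v ≠ u ∧ ∃ T, IsCycle L v T ∧ kPval L τ0 v u T ≠ 0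

section Configurations

variable {n k : ℕ}

lemma kRun_append (τ : Fin n → Fin k) (L L' : List (KMove n k)) :
    kRun τ (L ++ L') = kRun (kRun τ L) L' := by
  induction L generalizing τ with
  | nil => rfl
  | cons m L ih => exact ih _

lemma kConfAt_succ (τ0 : Fin n → Fin k) (L : List (KMove n k)) (t : Fin L.length) :
    kConfAt τ0 L (t + 1) = kStep (kConfAt τ0 L t) (L.get t) := by
  unfold kConfAt
  rw [List.take_succ_eq_append_getElem t.2, kRun_append]
  rfl

lemma kValid.get {τ : Fin n → Fin k} {L : List (KMove n k)} (h : kValid τ L)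
    (t : Fin L.length) :
    kConfAt τ L t (L.get t).1 = (L.get t).2.1 := by
  induction L generalizing τ with
  | nil => exact t.elim0
  | cons m L ih =>
    exact Fin.cases h.1 (fun t => ih h.2.2 t) t

lemma kValid.source_ne_target {τ : Fin n → Fin k} {L : List (KMove n k)}
    (h : kValid τ L) (t : Fin L.length) : (L.get t).2.1 ≠ (L.get t).2.2 := by
  induction L generalizing τ with
  | nil => exact t.elim0
  | cons m L ih => exact Fin.cases h.2.1 (ih h.2.2) t

lemma kConfAt_succ_self (τ0 : Fin n → Fin k) (L : List (KMove n k)) (t : Fin L.length) :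
    kConfAt τ0 L (t + 1) (L.get t).1 = (L.get t).2.2 := by
  simp [kConfAt_succ, kStep]

lemma kConfAt_eq_of_not_moved (τ0 : Fin n → Fin k) (L : List (KMove n k)) (u : Fin n)
    {a b : ℕ} (hab : a ≤ b) (hb : b ≤ L.length)
    (h : ∀ s : Fin L.length, a ≤ s → (s : ℕ) < b → (L.get s).1 ≠ u) :
    kConfAt τ0 L b u = kConfAt τ0 L a u := by
  induction b, hab using Nat.le_induction with
  | base => rfl
  | succ b hab ih =>
    rw [← ih (by omega) fun s h1 h2 => h s h1 (by omega)]
    have h1 := kConfAt_succ τ0 L ⟨b, hb⟩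
    have h2 := h ⟨b, hb⟩ hab (Nat.lt_succ_self b)
    simp only at h1
    rw [h1, kStep, Function.update_of_ne (Ne.symm h2)]

end Configurations

section Circuits

variable {n k : ℕ} {L : List (KMove n k)} {v : Fin n} {T : Finset (Fin L.length)}

lemma isChain_sort_iff_consecutive {α : Type*} [LinearOrder α] (T : Finset α)
    (R : α → α → Prop) :
    List.IsChain R (T.sort (· ≤ ·)) ↔
      ∀ a ∈ T, ∀ b ∈ T, a < b → (∀ c ∈ T, a < c → b ≤ c) → R a b := by
  have hs : (T.sort (· ≤ ·)).SortedLT := Finset.sortedLT_sort T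
  have hm : StrictMono (T.sort (· ≤ ·)).get := hs.strictMono_get
  rw [List.isChain_iff_getElem]
  constructor
  · intro h a ha b hb hab hc
    obtain ⟨i, rfl⟩ := List.mem_iff_get.1 ((Finset.mem_sort (· ≤ ·)).2 ha)
    obtain ⟨j, rfl⟩ := List.mem_iff_get.1 ((Finset.mem_sort (· ≤ ·)).2 hb)
    have hij : i < j := hm.lt_iff_lt.1 hab
    have hi : (i : ℕ) + 1 < (T.sort (· ≤ ·)).length := by have := j.2; omega
    have := hc ((T.sort (· ≤ ·)).get ⟨i + 1, hi⟩)
      ((Finset.mem_sort (· ≤ ·)).1 (List.get_mem _ _)) (hm (Fin.lt_def.2 (by simp)))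
    have h3 : j ≤ ⟨i + 1, hi⟩ := hm.le_iff_le.1 this
    have hj : j = ⟨i + 1, hi⟩ := by
      apply le_antisymm h3
      exact Fin.le_def.2 (Nat.succ_le_of_lt hij)
    subst hj
    exact h i hi
  · intro h i hi
    refine h _ ((Finset.mem_sort (· ≤ ·)).1 (List.getElem_mem _)) _
      ((Finset.mem_sort (· ≤ ·)).1 (List.getElem_mem _))
      (hm (a := ⟨i, by omega⟩) (b := ⟨i + 1, hi⟩) (Fin.lt_def.2 (by simp))) ?_
    intro c hc hlt
    obtain ⟨j, rfl⟩ := List.mem_iff_get.1 ((Finset.mem_sort (· ≤ ·)).2 hc)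
    have h1 : (⟨i, by omega⟩ : Fin (T.sort (· ≤ ·)).length) < j := hm.lt_iff_lt.1 hlt
    exact hm.monotone (a := ⟨i + 1, hi⟩) (b := j) (Fin.le_def.2 (Nat.succ_le_of_lt h1))

lemma isCircuit_iff : IsCircuit L v T ↔
    T.Nonempty ∧ (∀ t ∈ T, (L.get t).1 = v) ∧
    (∀ a ∈ T, ∀ b ∈ T, a < b → (∀ c ∈ T, a < c → b ≤ c) →
      (L.get a).2.2 = (L.get b).2.1) ∧
    ∀ a ∈ T, ∀ b ∈ T, (∀ c ∈ T, a ≤ c ∧ c ≤ b) → (L.get b).2.2 = (L.get a).2.1 := by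
  unfold IsCircuit
  refine and_congr_right fun hne => and_congr_right fun _ =>
    and_congr (isChain_sort_iff_consecutive T _) ⟨fun h a ha b hb hc => ?_, fun h _ => ?_⟩
  · have h1 : T.min' hne = a := le_antisymm (T.min'_le a ha) (hc _ (T.min'_mem hne)).1
    have h2 : T.max' hne = b := le_antisymm (hc _ (T.max'_mem hne)).2 (T.le_max' b hb)
    rw [← h1, ← h2]
    exact h hne
  · exact h _ (T.min'_mem hne) _ (T.max'_mem hne) fun c hc => ⟨T.min'_le c hc, T.le_max' c hc⟩

lemma IsCircuit.exists_isCycle (h : IsCircuit L v T) : ∃ T', IsCycle L v T' := by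
  obtain ⟨T', h1, h2⟩ := WellFounded.has_min (wellFounded_lt (α := Finset (Fin L.length)))
    {T | IsCircuit L v T} ⟨T, h⟩
  exact ⟨T', h1, fun S hS hc => h2 S hc hS⟩

/-- A vertex that returns to a previous part after moving is cyclic. -/
lemma mem_cyclicSet_of_return {τ0 : Fin n → Fin k} (hvalid : kValid τ0 L) {u : Fin n}
    {a b : ℕ} (hb : b ≤ L.length) (s : Fin L.length) (has : a ≤ s) (hsb : (s : ℕ) < b)
    (hs : (L.get s).1 = u) (heq : kConfAt τ0 L b u = kConfAt τ0 L a u) :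
    u ∈ cyclicSet L := by
  refine Finset.mem_filter.2 ⟨Finset.mem_univ _, IsCircuit.exists_isCycle
    (T := Finset.univ.filter fun t : Fin L.length => a ≤ t ∧ (t : ℕ) < b ∧ (L.get t).1 = u)
    (isCircuit_iff.2 ⟨⟨s, Finset.mem_filter.2 ⟨Finset.mem_univ _, has, hsb, hs⟩⟩, ?_⟩)⟩
  simp only [Finset.mem_filter, Finset.mem_univ, true_and]
  refine ⟨fun t ht => ht.2.2, ?_, ?_⟩
  · rintro x ⟨hx1, hx2, hx3⟩ y ⟨hy1, hy2, hy3⟩ hxy hc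
    have h1 := kConfAt_succ_self τ0 L x
    have h2 := hvalid.get y
    rw [hx3] at h1
    rw [hy3] at h2
    rw [← h1, ← h2]
    refine (kConfAt_eq_of_not_moved τ0 L u hxy y.2.le fun z hz1 hz2 hz3 => ?_).symm
    have := hc z ⟨by omega, by omega, hz3⟩ hz1
    exact absurd hz2 (not_lt.2 this)
  · rintro x ⟨hx1, hx2, hx3⟩ y ⟨hy1, hy2, hy3⟩ hc
    have h1 := hvalid.get x
    have h2 := kConfAt_succ_self τ0 L y
    rw [hx3] at h1
    rw [hy3] at h2
    rw [← h1, ← h2]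
    have h3 := kConfAt_eq_of_not_moved τ0 L u hx1 x.2.le fun z hz1 hz2 hz3 =>
      absurd hz2 (not_lt.2 (hc z ⟨hz1, by omega, hz3⟩).1)
    have h4 := kConfAt_eq_of_not_moved τ0 L u (a := y + 1) (b := b) hy2 hb
      fun z hz1 hz2 hz3 => absurd hz1 (by
        have : (z : ℕ) ≤ y := (hc z ⟨by omega, hz2, hz3⟩).2
        omega)
    rw [h3, ← h4, heq]

/-- Distinct moves of a cycle leave distinct parts. -/
lemma IsCycle.injOn_source (hC : IsCycle L v T) :
    Set.InjOn (fun t => (L.get t).2.1) (T : Set (Fin L.length)) := by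
  obtain ⟨_, hmv, hch, _⟩ := isCircuit_iff.1 hC.1
  have key : ∀ a ∈ T, ∀ b ∈ T, a < b → (L.get a).2.1 ≠ (L.get b).2.1 := by
    intro a ha b hb hab heq
    refine hC.2 (T.filter fun t => a ≤ t ∧ t < b) ?_ (isCircuit_iff.2 ?_)
    · exact Finset.filter_ssubset.2 ⟨b, hb, by simp⟩
    simp only [Finset.mem_filter]
    refine ⟨⟨a, by simp [ha, hab]⟩, fun t ht => hmv t ht.1, ?_, ?_⟩
    · rintro x ⟨hx, hax, hxb⟩ y ⟨hy, hay, hyb⟩ hxy hc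
      refine hch x hx y hy hxy fun c hcT hxc => ?_
      by_cases hcb : c < b
      · exact hc c ⟨hcT, hax.trans hxc.le, hcb⟩ hxc
      · exact hyb.le.trans (not_lt.1 hcb)
    · rintro x ⟨hx, hax, hxb⟩ y ⟨hy, hay, hyb⟩ hc
      have hxa : x = a := le_antisymm (hc a ⟨ha, le_rfl, hab⟩).1 hax
      subst hxa
      rw [heq]
      refine hch y hy b hb hyb fun c hcT hyc => ?_
      by_contra hcb
      exact absurd (hc c ⟨hcT, hay.trans hyc.le, not_le.1 hcb⟩).2 (not_le.2 hyc)
  intro a ha b hb heq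
  rcases lt_trichotomy a b with h | h | h
  · exact absurd heq (key a ha b hb h)
  · exact h
  · exact absurd heq.symm (key b hb a ha h)

/-- In max-`k`-cut every cycle has at most `k` moves. -/
lemma IsCycle.card_le (hC : IsCycle L v T) : T.card ≤ k := by
  simpa using Finset.card_le_card_of_injOn (t := (Finset.univ : Finset (Fin k)))
    (fun t => (L.get t).2.1) (by simp) hC.injOn_source

lemma kM_of_moved {τ0 : Fin n → Fin k} {u : Fin n} (huv : v ≠ u) {t : Fin L.length}
    (ht : (L.get t).1 = v) :
    kM L τ0 v u t = if (L.get t).2.2 = kConfAt τ0 L (t + 1) u then 1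
      else if (L.get t).2.1 = kConfAt τ0 L (t + 1) u then -1 else 0 := by
  unfold kM
  rw [ht]
  simp [huv.symm]

end Circuits

section Blocks

variable {n k : ℕ} {L : List (KMove n k)}

lemma exists_isCycBlock {t : ℕ} (ht : cycPos L t) :
    ∃ i j, IsCycBlock L i j ∧ i ≤ t ∧ t ≤ j := by
  have hlt : ∀ s, cycPos L s → s < L.length := fun s ⟨m, hm, _⟩ =>
    (List.getElem?_eq_some_iff.1 hm).1
  have hi : ∃ i, i ≤ t ∧ ∀ s, i ≤ s → s ≤ t → cycPos L s :=
    ⟨t, le_rfl, fun s h1 h2 => le_antisymm h1 h2 ▸ ht⟩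
  have hj : ∃ j, t ≤ j ∧ ¬ cycPos L (j + 1) :=
    ⟨t + L.length, by omega, fun h => absurd (hlt _ h) (by omega)⟩
  obtain ⟨i1, i2⟩ := Nat.find_spec hi
  obtain ⟨j1, j2⟩ := Nat.find_spec hj
  have hall : ∀ s, Nat.find hi ≤ s → s ≤ Nat.find hj → cycPos L s := by
    intro s h1 h2
    by_cases hst : s ≤ t
    · exact i2 s h1 hst
    · have h3 := Nat.find_min hj (m := s - 1) (by omega)
      rw [Nat.sub_add_cancel (by omega)] at h3
      by_contra h4
      exact h3 ⟨by omega, h4⟩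
  refine ⟨Nat.find hi, Nat.find hj, ⟨by omega, hlt _ (hall _ (by omega) le_rfl), hall, ?_, j2⟩,
    i1, j1⟩
  by_contra! h
  refine Nat.find_min hi (m := Nat.find hi - 1) (by omega) ⟨by omega, fun s h1 h2 => ?_⟩
  by_cases hs : s = Nat.find hi - 1
  · exact hs ▸ h.2
  · exact i2 s (by omega) h2

lemma IsCycBlock.exists_not_cycPos_between {i j i' j' t t' : ℕ} (h : IsCycBlock L i j)
    (h' : IsCycBlock L i' j') (hne : (i, j) ≠ (i', j')) (hi : i ≤ t) (hj : t ≤ j)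
    (hi' : i' ≤ t') (hj' : t' ≤ j') (htt' : t ≤ t') :
    ∃ s, t ≤ s ∧ s ≤ t' ∧ ¬ cycPos L s := by
  by_contra! hall
  obtain ⟨_, _, hc, hl, hr⟩ := h
  obtain ⟨_, _, hc', hl', hr'⟩ := h'
  have cover : ∀ s, min i i' ≤ s → s ≤ max j j' → cycPos L s := by
    intro s h1 h2
    by_cases h3 : t ≤ s ∧ s ≤ t'
    · exact hall s h3.1 h3.2
    by_cases h4 : i ≤ s ∧ s ≤ j
    · exact hc s h4.1 h4.2
    by_cases h5 : i' ≤ s ∧ s ≤ j'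
    · exact hc' s h5.1 h5.2
    omega
  refine hne (Prod.ext ?_ ?_)
  · rcases lt_trichotomy i i' with h | h | h
    · exact absurd (cover (i' - 1) (by omega) (by omega)) (hl'.resolve_left (by omega))
    · exact h
    · exact absurd (cover (i - 1) (by omega) (by omega)) (hl.resolve_left (by omega))
  · rcases lt_trichotomy j j' with h | h | h
    · exact absurd (cover (j + 1) (by omega) (by omega)) hr
    · exact h
    · exact absurd (cover (j' + 1) (by omega) (by omega)) hr'

lemma IsCycBlock.ne_of_not_cycPos_between {i j i' j' t s t' : ℕ} (h : IsCycBlock L i j)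
    (hi : i ≤ t) (hj' : t' ≤ j') (hts : t ≤ s) (hst' : s ≤ t') (hs : ¬ cycPos L s) :
    (i, j) ≠ (i', j') := by
  intro heq
  obtain ⟨rfl, rfl⟩ := Prod.mk.inj heq
  exact hs (h.2.2.1 s (by omega) (by omega))

lemma mem_acyclicSet_iff_not_cycPos (s : Fin L.length) :
    (L.get s).1 ∈ acyclicSet L ↔ ¬ cycPos L s := by
  have h1 : (L.get s).1 ∈ kS L :=
    List.mem_toFinset.2 (List.mem_map.2 ⟨_, List.get_mem _ _, rfl⟩)
  have h2 : cycPos L s ↔ (L.get s).1 ∈ cyclicSet L := by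
    simp [cycPos]
  rw [h2, acyclicSet, Finset.mem_sdiff]
  exact and_iff_right h1

lemma mem_segS_iff {u : Fin n} {a b : ℕ} :
    u ∈ segS L a b ↔ ∃ s : Fin L.length, a ≤ s ∧ (s : ℕ) ≤ b ∧ (L.get s).1 = u := by
  simp only [segS, Finset.mem_filter, Finset.mem_univ, true_and]
  constructor
  · rintro ⟨t, h1, h2, m, hm, rfl⟩
    obtain ⟨h3, rfl⟩ := List.getElem?_eq_some_iff.1 hm
    exact ⟨⟨t, h3⟩, h1, h2, rfl⟩
  · rintro ⟨s, h1, h2, rfl⟩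
    exact ⟨s, h1, h2, L.get s, by simp, rfl⟩

/-- Between a move of another vertex and a later time step, an acyclic vertex changes its part
exactly when it moves. -/
lemma kConfAt_ne_iff_mem_segS {τ0 : Fin n → Fin k} (hvalid : kValid τ0 L) {u v : Fin n}
    (hu : u ∈ acyclicSet L) (huv : v ≠ u) {a b : Fin L.length} (ha : (L.get a).1 = v)
    (hab : a < b) :
    kConfAt τ0 L (a + 1) u ≠ kConfAt τ0 L (b + 1) u ↔ u ∈ segS L a b := by
  have hab' : (a : ℕ) < b := hab
  rw [mem_segS_iff]
  constructor
  · contrapose!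
    intro h
    refine (kConfAt_eq_of_not_moved τ0 L u (by omega) b.2 fun s h1 h2 => ?_).symm
    exact h s (by omega) (by omega)
  · rintro ⟨s, h1, h2, h3⟩ heq
    have hsa : (s : ℕ) ≠ a := fun h => huv (by rw [← ha, ← h3, Fin.ext h])
    exact (Finset.mem_sdiff.1 hu).2 (mem_cyclicSet_of_return hvalid b.2 s (a := a + 1)
      (by omega) (by omega) h3 heq.symm)

end Blocks

lemma exists_lt_of_card_eq_two {α : Type*} [LinearOrder α] {T : Finset α} (h : T.card = 2) :
    ∃ a b, a < b ∧ T = {a, b} := by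
  obtain ⟨a, b, hab, rfl⟩ := Finset.card_eq_two.1 h
  rcases hab.lt_or_gt with h | h
  · exact ⟨a, b, h, rfl⟩
  · exact ⟨b, a, h, Finset.pair_comm a b⟩

lemma exists_lt_lt_of_card_eq_three {α : Type*} [LinearOrder α] {T : Finset α}
    (h : T.card = 3) : ∃ a b c, a < b ∧ b < c ∧ T = {a, b, c} := by
  let e := T.orderEmbOfFin h
  refine ⟨e 0, e 1, e 2, e.strictMono (by decide), e.strictMono (by decide), ?_⟩
  have : Set.range e = T := T.range_orderEmbOfFin h
  apply Finset.coe_injective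
  rw [← this]
  ext x
  simp [Fin.exists_fin_succ, eq_comm]

section MaxThreeCut

variable {n : ℕ} {L : List (KMove n 3)} {τ0 : Fin n → Fin 3} {u v : Fin n}

lemma kPval_pair_ne_zero (hvalid : kValid τ0 L) {a b : Fin L.length} (hab : a < b)
    (hC : IsCircuit L v {a, b}) (hu : u ∈ acyclicSet L) (huv : v ≠ u)
    (hseg : u ∈ segS L a b) : kPval L τ0 v u {a, b} ≠ 0 := by
  obtain ⟨_, hmv, hch, hcl⟩ := isCircuit_iff.1 hC
  have ha := hmv a (by simp)
  have hb := hmv b (by simp)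
  have h1 : (L.get a).2.2 = (L.get b).2.1 := hch a (by simp) b (by simp) hab (by simp)
  have h2 : (L.get b).2.2 = (L.get a).2.1 := hcl a (by simp) b (by simp) (by simp [hab.le])
  have h3 := (kConfAt_ne_iff_mem_segS hvalid hu huv ha hab).2 hseg
  have h4 := hvalid.source_ne_target a
  rw [kPval, Finset.sum_pair hab.ne, kM_of_moved huv ha, kM_of_moved huv hb, h2]
  rw [← h1]
  revert h3 h4
  generalize kConfAt τ0 L (a + 1) u = x
  generalize kConfAt τ0 L (b + 1) u = y
  generalize (L.get a).2.1 = p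
  generalize (L.get a).2.2 = q
  revert x y p q
  decide +kernel

lemma kPval_triple_ne_zero (hvalid : kValid τ0 L) {a b c : Fin L.length} (hab : a < b)
    (hbc : b < c) (hC : IsCycle L v {a, b, c}) (hu : u ∈ acyclicSet L) (huv : v ≠ u)
    (hseg : ¬ (u ∈ segS L a b ↔ u ∈ segS L b c)) : kPval L τ0 v u {a, b, c} ≠ 0 := by
  obtain ⟨_, hmv, hch, hcl⟩ := isCircuit_iff.1 hC.1
  have ha := hmv a (by simp)
  have hb := hmv b (by simp)
  have hc := hmv c (by simp)
  have hac := hab.trans hbc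
  have h1 : (L.get a).2.2 = (L.get b).2.1 :=
    hch a (by simp) b (by simp) hab (by simp [hbc.le])
  have h2 : (L.get b).2.2 = (L.get c).2.1 :=
    hch b (by simp) c (by simp) hbc (by simp [hab.le])
  have h3 : (L.get c).2.2 = (L.get a).2.1 :=
    hcl a (by simp) c (by simp) (by simp [hab.le, hbc.le, hac.le])
  have h4 : (L.get a).2.1 ≠ (L.get c).2.1 :=
    fun h => hac.ne (hC.injOn_source (by simp) (by simp) h)
  have h5 := hvalid.source_ne_target a
  have h6 := hvalid.source_ne_target b
  rw [← kConfAt_ne_iff_mem_segS hvalid hu huv ha hab,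
    ← kConfAt_ne_iff_mem_segS hvalid hu huv hb hbc] at hseg
  rw [kPval, Finset.sum_insert (by simp [hab.ne, hac.ne]), Finset.sum_pair hbc.ne,
    kM_of_moved huv ha, kM_of_moved huv hb, kM_of_moved huv hc, h3]
  rw [h1, h2] at *
  revert hseg h4 h5 h6
  generalize kConfAt τ0 L (a + 1) u = x
  generalize kConfAt τ0 L (b + 1) u = y
  generalize kConfAt τ0 L (c + 1) u = z
  generalize (L.get a).2.1 = p
  generalize (L.get b).2.1 = q
  generalize (L.get c).2.1 = r
  revert x y z p q r
  decide +kernel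

end MaxThreeCut

/-- non-tricky leaping cycles yield good arcs, max-3-cut on the complete
graph. If `C` is a non-tricky leaping cycle over `v` of a valid sequence `L`, then some
acyclic vertex `u` appearing in `L` between `t_beg(C)` and `t_end(C)` gives an
`L`-good-arc `vu`. -/
theorem nontricky_leaping_gives_goodArc {n : ℕ}
    (L : List (KMove n 3)) (τ0 : Fin n → Fin 3) (hvalid : kValid τ0 L)
    (v : Fin n) (T : Finset (Fin L.length)) (hC : IsCycle L v T)
    (hleap : Leaping L T) (htricky : ¬ Tricky L T) :
    ∃ u : Fin n, u ∈ acyclicSet L ∧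
      (∃ s : Fin L.length, (T.min' hC.1.1 : ℕ) ≤ (s : ℕ) ∧ (s : ℕ) ≤ (T.max' hC.1.1 : ℕ) ∧
        (L.get s).1 = u) ∧
      k3GoodArc L τ0 v u := by
  obtain ⟨i1, j1, i2, j2, hB1, hB2, hne, ⟨t1, ht1, hi1, hj1⟩, t2, ht2, hi2, hj2⟩ := hleap
  have hmv : ∀ t ∈ T, (L.get t).1 = v := hC.1.2.1
  have hvcyc : v ∈ cyclicSet L := Finset.mem_filter.2 ⟨Finset.mem_univ _, T, hC⟩
  have hvne : ∀ u ∈ acyclicSet L, v ≠ u := fun u hu h =>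
    (Finset.mem_sdiff.1 hu).2 (h ▸ hvcyc)
  have hpos : ∀ t ∈ T, cycPos L t := fun t ht =>
    ⟨L.get t, by simp, by rw [hmv t ht]; exact hvcyc⟩
  obtain ⟨s, hs1, hs2, hs⟩ : ∃ s : Fin L.length,
      T.min' hC.1.1 ≤ s ∧ s ≤ T.max' hC.1.1 ∧ ¬ cycPos L s := by
    rcases le_total t1 t2 with h | h
    · obtain ⟨s, h1, h2, h3⟩ := hB1.exists_not_cycPos_between hB2 hne hi1 hj1 hi2 hj2 h
      exact ⟨⟨s, h2.trans_lt t2.2⟩, (T.min'_le _ ht1).trans h1,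
        le_trans (b := t2) h2 (T.le_max' _ ht2), h3⟩
    · obtain ⟨s, h1, h2, h3⟩ := hB2.exists_not_cycPos_between hB1 hne.symm hi2 hj2 hi1 hj1 h
      exact ⟨⟨s, h2.trans_lt t1.2⟩, (T.min'_le _ ht2).trans h1,
        le_trans (b := t1) h2 (T.le_max' _ ht1), h3⟩
  have hsA := (mem_acyclicSet_iff_not_cycPos s).2 hs
  have htwo : 2 ≤ T.card := by
    refine Finset.one_lt_card.2 ⟨_, T.min'_mem hC.1.1, _, T.max'_mem hC.1.1, fun h => hs ?_⟩
    rw [le_antisymm hs2 (h ▸ hs1)]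
    exact hpos _ (T.max'_mem hC.1.1)
  have hthree := hC.card_le
  obtain hcard | hcard : T.card = 2 ∨ T.card = 3 := by omega
  · obtain ⟨a, b, hab, rfl⟩ := exists_lt_of_card_eq_two hcard
    have has : a ≤ s := (Finset.le_min' _ _ _ (by simp [hab.le])).trans hs1
    have hsb : s ≤ b := hs2.trans (Finset.max'_le _ _ _ (by simp [hab.le]))
    exact ⟨_, hsA, ⟨s, hs1, hs2, rfl⟩, hvne _ hsA, _, hC, kPval_pair_ne_zero hvalid hab hC.1 hsA
      (hvne _ hsA) (mem_segS_iff.2 ⟨s, has, hsb, rfl⟩)⟩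
  · obtain ⟨a, b, c, hab, hbc, rfl⟩ := exists_lt_lt_of_card_eq_three hcard
    have hac := hab.trans hbc
    have hmin : Finset.min' {a, b, c} hC.1.1 = a :=
      le_antisymm (Finset.min'_le _ _ (by simp))
        (Finset.le_min' _ _ _ (by simp [hab.le, hac.le]))
    have hmax : Finset.max' {a, b, c} hC.1.1 = c :=
      le_antisymm (Finset.max'_le _ _ _ (by simp [hbc.le, hac.le]))
        (Finset.le_max' _ _ (by simp))
    rw [hmin] at hs1 ⊢
    rw [hmax] at hs2 ⊢
    by_cases hex : ∃ u ∈ acyclicSet L, ¬ (u ∈ segS L a b ↔ u ∈ segS L b c)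
    · obtain ⟨u, hu, hseg⟩ := hex
      have hmoved : u ∈ segS L a b ∨ u ∈ segS L b c := by tauto
      refine ⟨u, hu, ?_, hvne u hu, _, hC, kPval_triple_ne_zero hvalid hab hbc hC hu
        (hvne u hu) hseg⟩
      rcases hmoved with h | h <;> obtain ⟨r, h1, h2, h3⟩ := mem_segS_iff.1 h
      · exact ⟨r, h1, h2.trans hbc.le, h3⟩
      · exact ⟨r, le_trans (b := (b : ℕ)) hab.le h1, h2, h3⟩
    · push Not at hex
      have hboth : (L.get s).1 ∈ segS L a b ∧ (L.get s).1 ∈ segS L b c := by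
        rcases le_total s b with h | h
        · have hm := mem_segS_iff.2 ⟨s, hs1, h, rfl⟩
          exact ⟨hm, (hex _ hsA).1 hm⟩
        · have hm := mem_segS_iff.2 ⟨s, h, hs2, rfl⟩
          exact ⟨(hex _ hsA).2 hm, hm⟩
      obtain ⟨x, hax, hxb, hx⟩ := mem_segS_iff.1 hboth.1
      obtain ⟨y, hby, hyc, hy⟩ := mem_segS_iff.1 hboth.2
      have hxpos : ¬ cycPos L x := (mem_acyclicSet_iff_not_cycPos x).1 (hx ▸ hsA)
      have hypos : ¬ cycPos L y := (mem_acyclicSet_iff_not_cycPos y).1 (hy ▸ hsA)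
      obtain ⟨ia, ja, hBa, hia, hja⟩ := exists_isCycBlock (hpos a (by simp))
      obtain ⟨ib, jb, hBb, hib, hjb⟩ := exists_isCycBlock (hpos b (by simp))
      obtain ⟨ic, jc, hBc, hic, hjc⟩ := exists_isCycBlock (hpos c (by simp))
      refine absurd ⟨a, b, c, hab, hbc, rfl, ⟨ia, ja, ib, jb, ic, jc, hBa, hBb, hBc,
        hBa.ne_of_not_cycPos_between hia hjb hax hxb hxpos,
        hBb.ne_of_not_cycPos_between hib hjc hby hyc hypos,
        hBa.ne_of_not_cycPos_between hia hjc hax (hxb.trans hbc.le) hxpos,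
        hia, hja, hib, hjb, hic, hjc⟩, ?_⟩ htricky
      ext u
      simp only [Finset.mem_inter]
      exact and_congr_right (hex u)
end
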